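/- Let f : {0,1}^n → {±1} be computable by a decision tree of size s ≥ 2, let ε ∈ (0,1), and let T° be a bare tree with L leaves such that cost_f(T°) ≥ ε·log₂(4s/ε). Then there exist a leaf ℓ of T° and a variable i ∈ [n] with 2^{−|ℓ|}·Inf_i(f_ℓ) ≥ cost_f(T°)/(L·log₂(4s/ε)·log₂ s). -/

import Mathlib

/- Common definitions: decision trees, bare trees, influence, and the
   BuildTopDownDT top-down heuristic (modelled as a nondeterministic step
   relation, so that all tie-breakings are covered). -/

noncomputable section

namespace TopDownDT

/-- Influence of variable `i` on a Boolean function over a finite index set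
(`true` codes +1, `false` codes −1). -/
def influence {I : Type} [Fintype I] [DecidableEq I]
    (f : (I → Bool) → Bool) (i : I) : ℝ :=
  ((Finset.univ.filter fun x : I → Bool =>
      f x ≠ f (Function.update x i (!x i))).card : ℝ) / 2 ^ Fintype.card I

/-- Total influence. -/
def totalInfluence {I : Type} [Fintype I] [DecidableEq I]
    (f : (I → Bool) → Bool) : ℝ :=
  ∑ i : I, influence f i

variable {n : ℕ}

/-- Override inputs according to a partial assignment (earlier entries take precedence). -/
def override (π : List (Fin n × Bool)) (x : Fin n → Bool) : Fin n → Bool :=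
  fun i =>
    match π.find? (fun p => decide (p.1 = i)) with
    | some p => p.2
    | none => x i

/-- Restriction of `f` by the partial assignment `π` (as a function on the whole cube;
the fixed coordinates become irrelevant). -/
def restrictList (f : (Fin n → Bool) → Bool) (π : List (Fin n × Bool)) :
    (Fin n → Bool) → Bool :=
  fun x => f (override π x)

/-- Decision trees with ±1 leaves (`true` codes +1, `false` codes −1). -/
inductive DecTree (n : ℕ) : Type
  | leaf : Bool → DecTree n
  | node : Fin n → DecTree n → DecTree n → DecTree n
  deriving DecidableEq

/-- Evaluation of a decision tree. -/
def DecTree.eval : DecTree n → (Fin n → Bool) → Bool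
  | .leaf b, _ => b
  | .node i t0 t1, x => if x i then t1.eval x else t0.eval x

/-- Size (number of leaves) of a decision tree. -/
def DecTree.size : DecTree n → ℕ
  | .leaf _ => 1
  | .node _ t0 t1 => t0.size + t1.size

/-- Depth of a decision tree. -/
def DecTree.depth : DecTree n → ℕ
  | .leaf _ => 0
  | .node _ t0 t1 => max t0.depth t1.depth + 1

/-- Number of queries the tree makes on input `x` (the depth of the leaf reached by `x`). -/
def DecTree.pathLen : DecTree n → (Fin n → Bool) → ℕ
  | .leaf _, _ => 0
  | .node i t0 t1, x => (if x i then t1.pathLen x else t0.pathLen x) + 1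

/-- The optimal decision tree size of `f`: the least size of a decision tree computing `f`. -/
def optSize (f : (Fin n → Bool) → Bool) : ℕ :=
  sInf {s : ℕ | ∃ T : DecTree n, (∀ x, T.eval x = f x) ∧ T.size = s}

/-- Bare trees: decision trees with unlabeled leaves. -/
inductive BareTree (n : ℕ) : Type
  | leaf : BareTree n
  | node : Fin n → BareTree n → BareTree n → BareTree n
  deriving DecidableEq

/-- Size (number of leaves) of a bare tree. -/
def BareTree.size : BareTree n → ℕ
  | .leaf => 1
  | .node _ t0 t1 => t0.size + t1.size

/-- Root-to-leaf paths of a bare tree, recorded as lists of (variable, value) pairs. -/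
def BareTree.leafPaths : BareTree n → List (List (Fin n × Bool))
  | .leaf => [[]]
  | .node i t0 t1 =>
      (t0.leafPaths.map fun p => (i, false) :: p) ++
      (t1.leafPaths.map fun p => (i, true) :: p)

/-- Replace the leaf at the end of the path `π` by the bare tree `t`. -/
def BareTree.replaceLeaf : BareTree n → List (Fin n × Bool) → BareTree n → BareTree n
  | .leaf, [], t => t
  | .leaf, _ :: _, _ => .leaf
  | .node i t0 t1, [], _ => .node i t0 t1
  | .node i t0 t1, p :: ps, t =>
      if p.2 then .node i t0 (t1.replaceLeaf ps t)
      else .node i (t0.replaceLeaf ps t) t1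

/-- The `f`-completion: label each leaf `ℓ` by the sign of `E[f_ℓ]`. -/
def completionAux (f : (Fin n → Bool) → Bool) :
    BareTree n → List (Fin n × Bool) → DecTree n
  | .leaf, π =>
      .leaf (decide (2 ^ n ≤ 2 * (Finset.univ.filter fun x => restrictList f π x = true).card))
  | .node i t0 t1, π =>
      .node i (completionAux f t0 (π ++ [(i, false)]))
              (completionAux f t1 (π ++ [(i, true)]))

/-- The `f`-completion of a bare tree. -/
def completion (f : (Fin n → Bool) → Bool) (T : BareTree n) : DecTree n :=
  completionAux f T []

/-- Fraction of points of the cube on which `f` and `g` disagree. -/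
def errf (f g : (Fin n → Bool) → Bool) : ℝ :=
  ((Finset.univ.filter fun x => f x ≠ g x).card : ℝ) / 2 ^ n

/-- Error of the `f`-completion of a bare tree with respect to `f`. -/
def completionErr (f : (Fin n → Bool) → Bool) (T : BareTree n) : ℝ :=
  errf f (completion f T).eval

/-- Score of the leaf with path `π`: `2^{-|ℓ|} · max_i Inf_i(f_ℓ)`. -/
def leafScore (f : (Fin n → Bool) → Bool) (π : List (Fin n × Bool)) : ℝ :=
  ((1 : ℝ) / 2) ^ π.length * ⨆ i : Fin n, influence (restrictList f π) i

/-- `i` is a most influential variable of `g`. -/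
def IsMaxInfl (g : (Fin n → Bool) → Bool) (i : Fin n) : Prop :=
  ∀ j : Fin n, influence g j ≤ influence g i

/-- One step of BuildTopDownDT: replace a maximum-score leaf by a query to a most
influential variable of the corresponding restriction of `f`. -/
def SplitStep (f : (Fin n → Bool) → Bool) (T T' : BareTree n) : Prop :=
  ∃ π ∈ T.leafPaths, ∃ i : Fin n,
    (∀ π' ∈ T.leafPaths, leafScore f π' ≤ leafScore f π) ∧
    IsMaxInfl (restrictList f π) i ∧
    T' = T.replaceLeaf π (.node i .leaf .leaf)

/-- A (partial) run of `BuildTopDownDT(f, ε)` of length `m`, under an arbitrary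
tie-breaking rule: it starts from the single unlabeled leaf and, as long as the
`f`-completion is not an `ε`-approximation of `f`, performs a valid split. -/
def IsRun (f : (Fin n → Bool) → Bool) (ε : ℝ) (m : ℕ) (g : ℕ → BareTree n) : Prop :=
  g 0 = BareTree.leaf ∧
  ∀ j < m, ε < completionErr f (g j) ∧ SplitStep f (g j) (g (j + 1))

/-- Monotonicity of a Boolean function (with `false ≤ true`). -/
def MonotoneBF (f : (Fin n → Bool) → Bool) : Prop :=
  ∀ x y : Fin n → Bool, (∀ i, x i ≤ y i) → f x ≤ f y

/-- Cost of a bare tree relative to `f`:  `Σ_ℓ 2^{-|ℓ|} · Inf(f_ℓ)`. -/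
def costf (f : (Fin n → Bool) → Bool) (T : BareTree n) : ℝ :=
  (T.leafPaths.map fun π =>
    ((1 : ℝ) / 2) ^ π.length * totalInfluence (restrictList f π)).sum

/-- Variance of a Boolean function: `4 · Pr[f = −1] · Pr[f = +1]`. -/
def varf (f : (Fin n → Bool) → Bool) : ℝ :=
  4 * (((Finset.univ.filter fun x => f x = false).card : ℝ) / 2 ^ n) *
      (((Finset.univ.filter fun x => f x = true).card : ℝ) / 2 ^ n)

/-- Expectation `E[f(x)]` of a ±1-valued Boolean function over a uniform input. -/
def expVal (f : (Fin n → Bool) → Bool) : ℝ :=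
  (∑ x : Fin n → Bool, if f x then (1 : ℝ) else -1) / 2 ^ n

end TopDownDT

open TopDownDT

namespace TopDownDT

variable {n : ℕ}

/-- Expectation of a real-valued function over the uniform distribution on the cube. -/
def cubeMean (h : (Fin n → Bool) → ℝ) : ℝ := (∑ x, h x) / 2 ^ n

/-- The point `x` with its `i`-th bit flipped. -/
def flipAt (i : Fin n) (x : Fin n → Bool) : Fin n → Bool := Function.update x i (!x i)

/-- The ±1 value of a Boolean. -/
def boolSign (b : Bool) : ℝ := if b then 1 else -1

lemma flipAt_flipAt (i : Fin n) (x : Fin n → Bool) : flipAt i (flipAt i x) = x := by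
  simp [flipAt]

lemma cubeMean_flipAt (h : (Fin n → Bool) → ℝ) (i : Fin n) :
    cubeMean (fun x => h (flipAt i x)) = cubeMean h := by
  unfold cubeMean
  congr 1
  exact Fintype.sum_bijective (flipAt i)
    (Function.Involutive.bijective (flipAt_flipAt i)) _ _ fun _ => rfl

lemma cubeMean_add (g h : (Fin n → Bool) → ℝ) :
    cubeMean (fun x => g x + h x) = cubeMean g + cubeMean h := by
  simp only [cubeMean, Finset.sum_add_distrib, add_div]

lemma cubeMean_const_mul (c : ℝ) (h : (Fin n → Bool) → ℝ) :
    cubeMean (fun x => c * h x) = c * cubeMean h := by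
  simp only [cubeMean, ← Finset.mul_sum, mul_div_assoc]

lemma cubeMean_mono {g h : (Fin n → Bool) → ℝ} (hgh : ∀ x, g x ≤ h x) :
    cubeMean g ≤ cubeMean h := by
  unfold cubeMean
  gcongr
  exact hgh _

lemma cubeMean_const (c : ℝ) : cubeMean (fun _ : Fin n → Bool => c) = c := by
  simp [cubeMean]

lemma cubeMean_eq_of_forall_eq {h : (Fin n → Bool) → ℝ} {c : ℝ} (hh : ∀ x, h x = c) :
    cubeMean h = c := by
  rw [funext hh, cubeMean_const]

lemma cubeMean_nonneg {h : (Fin n → Bool) → ℝ} (hh : ∀ x, 0 ≤ h x) : 0 ≤ cubeMean h :=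
  (cubeMean_const (n := n) 0).symm.le.trans (cubeMean_mono hh)

lemma cubeMean_eq_half_add (h : (Fin n → Bool) → ℝ) (i : Fin n) :
    cubeMean h = (cubeMean (fun x => h (Function.update x i false)) +
      cubeMean (fun x => h (Function.update x i true))) / 2 := by
  have key : cubeMean (fun x => h (Function.update x i false)) +
      cubeMean (fun x => h (Function.update x i true)) =
      cubeMean h + cubeMean (fun x => h (flipAt i x)) := by
    rw [← cubeMean_add, ← cubeMean_add]
    congr 1
    funext x
    have hx := Function.update_eq_self i x
    cases hxi : x i <;> rw [hxi] at hx <;> simp [flipAt, hxi, hx, add_comm]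
  rw [key, cubeMean_flipAt]
  ring

lemma cubeMean_ite (p : (Fin n → Bool) → Prop) [DecidablePred p] :
    cubeMean (fun x => if p x then (1 : ℝ) else 0) =
      ((Finset.univ.filter p).card : ℝ) / 2 ^ n := by
  simp [cubeMean, Finset.sum_boole]

lemma influence_eq_cubeMean (g : (Fin n → Bool) → Bool) (i : Fin n) :
    influence g i = cubeMean (fun x => if g x ≠ g (flipAt i x) then (1 : ℝ) else 0) := by
  rw [cubeMean_ite, influence, Fintype.card_fin]
  unfold flipAt
  congr!

lemma influence_nonneg (g : (Fin n → Bool) → Bool) (i : Fin n) : 0 ≤ influence g i := by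
  unfold influence
  positivity

/-- Functions computed by decision trees with at most `s` leaves. -/
def ComputableInSize (g : (Fin n → Bool) → Bool) (s : ℕ) : Prop :=
  ∃ T : DecTree n, (∀ x, T.eval x = g x) ∧ T.size ≤ s

lemma DecTree.one_le_size (T : DecTree n) : 1 ≤ T.size := by
  induction T with
  | leaf b => exact le_rfl
  | node i t0 t1 h0 h1 => simp only [DecTree.size]; omega

lemma ComputableInSize.update {g : (Fin n → Bool) → Bool} {s : ℕ} (hg : ComputableInSize g s)
    (i : Fin n) (b : Bool) :
    ComputableInSize (fun x => g (Function.update x i b)) s := by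
  suffices h : ∀ T : DecTree n, ∃ T' : DecTree n,
      (∀ x, T'.eval x = T.eval (Function.update x i b)) ∧ T'.size ≤ T.size by
    obtain ⟨T, hT, hs⟩ := hg
    obtain ⟨T', hT', hs'⟩ := h T
    exact ⟨T', fun x => (hT' x).trans (hT _), hs'.trans hs⟩
  intro T
  induction T with
  | leaf c => exact ⟨.leaf c, fun _ => rfl, le_rfl⟩
  | node j t0 t1 h0 h1 =>
    obtain ⟨t0', e0, s0⟩ := h0
    obtain ⟨t1', e1, s1⟩ := h1
    by_cases hj : j = i
    · subst hj
      cases b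
      · exact ⟨t0', fun x => by simp [DecTree.eval, e0], by simp only [DecTree.size]; omega⟩
      · exact ⟨t1', fun x => by simp [DecTree.eval, e1], by simp only [DecTree.size]; omega⟩
    · exact ⟨.node j t0' t1', fun x => by simp [DecTree.eval, e0, e1, hj],
        by simp only [DecTree.size]; omega⟩

lemma ComputableInSize.restrictList (π : List (Fin n × Bool)) {g : (Fin n → Bool) → Bool}
    {s : ℕ} (hg : ComputableInSize g s) : ComputableInSize (restrictList g π) s := by
  induction π generalizing g with
  | nil => exact hg
  | cons p π ih =>
    have h : TopDownDT.restrictList g (p :: π) =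
        TopDownDT.restrictList (fun x => g (Function.update x p.1 p.2)) π := by
      funext x
      simp only [TopDownDT.restrictList]
      congr 1
      funext j
      by_cases hj : j = p.1
      · subst hj
        simp [override]
      · simp [override, hj, Ne.symm hj]
    rw [h]
    exact ih (hg.update p.1 p.2)

/-- Induction on functions computed by decision trees, via the two restrictions of the
function by the variable at the root. -/
lemma ComputableInSize.induction {P : ((Fin n → Bool) → Bool) → ℕ → Prop}
    (const : ∀ b s, 1 ≤ s → P (fun _ => b) s)
    (node : ∀ g i s0 s1 s, 1 ≤ s0 → 1 ≤ s1 → s0 + s1 ≤ s →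
      P (fun x => g (Function.update x i false)) s0 →
      P (fun x => g (Function.update x i true)) s1 → P g s)
    {g : (Fin n → Bool) → Bool} {s : ℕ} (hg : ComputableInSize g s) : P g s := by
  induction s using Nat.strong_induction_on generalizing g with
  | _ s ih =>
    obtain ⟨T, hT, hs⟩ := hg
    cases T with
    | leaf b =>
      obtain rfl : (fun _ => b) = g := funext hT
      exact const b s hs
    | node i t0 t1 =>
      have p0 := t0.one_le_size
      have p1 := t1.one_le_size
      simp only [DecTree.size] at hs
      have c0 := ComputableInSize.update ⟨t0, fun _ => rfl, le_rfl⟩ i false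
      have c1 := ComputableInSize.update ⟨t1, fun _ => rfl, le_rfl⟩ i true
      have e0 : (fun x => t0.eval (Function.update x i false)) =
          fun x => g (Function.update x i false) := by
        funext x; simp [← hT, DecTree.eval]
      have e1 : (fun x => t1.eval (Function.update x i true)) =
          fun x => g (Function.update x i true) := by
        funext x; simp [← hT, DecTree.eval]
      rw [e0] at c0
      rw [e1] at c1
      exact node g i _ _ s p0 p1 hs (ih _ (by omega) c0) (ih _ (by omega) c1)

lemma cubeMean_abs_sub_update (g : (Fin n → Bool) → Bool) (i : Fin n) (c : Bool) :
    cubeMean (fun x => |boolSign (g (Function.update x i c)) - boolSign (g x)|) =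
      influence g i := by
  have key : ∀ x, |boolSign (g (Function.update x i c)) - boolSign (g x)| +
      |boolSign (g (Function.update (flipAt i x) i c)) - boolSign (g (flipAt i x))| =
      2 * if g x ≠ g (flipAt i x) then (1 : ℝ) else 0 := by
    intro x
    have hx := Function.update_eq_self i x
    have hf : Function.update (flipAt i x) i c = Function.update x i c := by simp [flipAt]
    rw [hf]
    by_cases hc : x i = c
    · rw [← hc, hx]
      cases g x <;> cases g (flipAt i x) <;> norm_num [boolSign]
    · have : Function.update x i c = flipAt i x := by
        rw [flipAt]; congr 1; cases hh : x i <;> cases c <;> simp_all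
      rw [this]
      cases g x <;> cases g (flipAt i x) <;> norm_num [boolSign]
  have h2 := cubeMean_add
    (fun x => |boolSign (g (Function.update x i c)) - boolSign (g x)|)
    (fun x => |boolSign (g (Function.update (flipAt i x) i c)) - boolSign (g (flipAt i x))|)
  simp only [key] at h2
  rw [cubeMean_const_mul, ← influence_eq_cubeMean,
    cubeMean_flipAt (fun x => |boolSign (g (Function.update x i c)) - boolSign (g x)|) i] at h2
  linarith

lemma cubeMean_mul_update_le (f g : (Fin n → Bool) → Bool) (i : Fin n) (c : Bool) :
    cubeMean (fun x => boolSign (f x) * boolSign (g (Function.update x i c))) ≤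
      cubeMean (fun x => boolSign (f x) * boolSign (g x)) + influence g i := by
  rw [← cubeMean_abs_sub_update g i c, ← cubeMean_add]
  refine cubeMean_mono fun x => ?_
  cases f x <;> cases g (Function.update x i c) <;> cases g x <;> norm_num [boolSign]

lemma one_add_half_logb_add_le {a b : ℝ} (ha : 0 < a) (hb : 0 < b) :
    1 + (Real.logb 2 a + Real.logb 2 b) / 2 ≤ Real.logb 2 (a + b) := by
  have h : Real.logb 2 (2 ^ 2 * (a * b)) ≤ Real.logb 2 ((a + b) ^ 2) := by
    apply Real.logb_le_logb_of_le (by norm_num) (by positivity)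
    nlinarith [sq_nonneg (a - b)]
  rw [Real.logb_mul (by norm_num) (by positivity), Real.logb_mul ha.ne' hb.ne',
    Real.logb_pow, Real.logb_pow, Real.logb_self_eq_one (by norm_num)] at h
  push_cast at h
  linarith

/-- The OSSS inequality, in its two-function form. -/
lemma covariance_le_mul_logb {f : (Fin n → Bool) → Bool} {s : ℕ} (hf : ComputableInSize f s)
    (g : (Fin n → Bool) → Bool) {M : ℝ} (hM0 : 0 ≤ M) (hM : ∀ i, influence g i ≤ M) :
    cubeMean (fun x => boolSign (f x) * boolSign (g x)) -
      cubeMean (fun x => boolSign (f x)) * cubeMean (fun x => boolSign (g x)) ≤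
      M * Real.logb 2 s := by
  refine ComputableInSize.induction (P := fun f s =>
    cubeMean (fun x => boolSign (f x) * boolSign (g x)) -
      cubeMean (fun x => boolSign (f x)) * cubeMean (fun x => boolSign (g x)) ≤
      M * Real.logb 2 s) ?_ ?_ hf
  · intro b s hs
    rw [cubeMean_const_mul, cubeMean_const, sub_self]
    exact mul_nonneg hM0 (Real.logb_nonneg (by norm_num) (by exact_mod_cast hs))
  · intro f i s0 s1 s h0 h1 hs ih0 ih1
    have e := cubeMean_eq_half_add (fun x => boolSign (f x) * boolSign (g x)) i
    have e' := cubeMean_eq_half_add (fun x => boolSign (f x)) i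
    have l0 := cubeMean_mul_update_le (fun x => f (Function.update x i false)) g i false
    have l1 := cubeMean_mul_update_le (fun x => f (Function.update x i true)) g i true
    have hp0 : (0 : ℝ) < s0 := by exact_mod_cast h0
    have hp1 : (0 : ℝ) < s1 := by exact_mod_cast h1
    have hl : 1 + (Real.logb 2 s0 + Real.logb 2 s1) / 2 ≤ Real.logb 2 s :=
      (one_add_half_logb_add_le hp0 hp1).trans
        (Real.logb_le_logb_of_le (by norm_num) (by positivity) (by exact_mod_cast hs))
    have hl' := mul_le_mul_of_nonneg_left hl hM0
    have := hM i
    rw [e, e']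
    linarith

/-- The probability that `g` takes the value `b`. -/
def valueProb (g : (Fin n → Bool) → Bool) (b : Bool) : ℝ :=
  cubeMean (fun x => if g x = b then (1 : ℝ) else 0)

lemma valueProb_nonneg (g : (Fin n → Bool) → Bool) (b : Bool) : 0 ≤ valueProb g b :=
  cubeMean_nonneg fun x => by split_ifs <;> norm_num

lemma valueProb_add_valueProb_not (g : (Fin n → Bool) → Bool) (b : Bool) :
    valueProb g b + valueProb g (!b) = 1 := by
  rw [valueProb, valueProb, ← cubeMean_add]
  refine cubeMean_eq_of_forall_eq fun x => ?_
  cases g x <;> cases b <;> simp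

lemma varf_eq_valueProb (g : (Fin n → Bool) → Bool) (b : Bool) :
    varf g = 4 * valueProb g b * valueProb g (!b) := by
  unfold varf valueProb
  rw [cubeMean_ite, cubeMean_ite]
  cases b
  · rfl
  · simp only [Bool.not_true]
    ring

lemma varf_eq_covariance (g : (Fin n → Bool) → Bool) :
    varf g = cubeMean (fun x => boolSign (g x) * boolSign (g x)) -
      cubeMean (fun x => boolSign (g x)) * cubeMean (fun x => boolSign (g x)) := by
  have h1 : cubeMean (fun x => boolSign (g x) * boolSign (g x)) = 1 := by
    refine cubeMean_eq_of_forall_eq fun x => ?_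
    cases g x <;> norm_num [boolSign]
  have h2 : cubeMean (fun x => boolSign (g x)) = valueProb g true + (-1) * valueProb g false := by
    rw [valueProb, valueProb, ← cubeMean_const_mul, ← cubeMean_add]
    congr 1
    funext x
    cases g x <;> norm_num [boolSign]
  have h3 := valueProb_add_valueProb_not g true
  rw [varf_eq_valueProb g true, h1, h2]
  simp only [Bool.not_true] at *
  rw [← eq_sub_iff_add_eq'] at h3
  rw [h3]
  ring

/-- The OSSS inequality. -/
lemma exists_varf_le_influence_mul_logb [Nonempty (Fin n)] {g : (Fin n → Bool) → Bool} {s : ℕ}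
    (hg : ComputableInSize g s) : ∃ i, varf g ≤ influence g i * Real.logb 2 s := by
  obtain ⟨i, hi⟩ := Finite.exists_max (influence g)
  refine ⟨i, ?_⟩
  rw [varf_eq_covariance]
  exact covariance_le_mul_logb hg g (influence_nonneg g i) hi

/-- The probability that `g` takes the value `b` and is sensitive to the `j`-th bit. -/
def sensitiveProb (g : (Fin n → Bool) → Bool) (b : Bool) (j : Fin n) : ℝ :=
  cubeMean (fun x => if g x = b ∧ g x ≠ g (flipAt j x) then (1 : ℝ) else 0)

lemma influence_eq_two_mul_sensitiveProb (g : (Fin n → Bool) → Bool) (b : Bool) (j : Fin n) :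
    influence g j = 2 * sensitiveProb g b j := by
  have h := cubeMean_flipAt
    (fun x => if g x = b ∧ g x ≠ g (flipAt j x) then (1 : ℝ) else 0) j
  have h2 : influence g j = sensitiveProb g b j + sensitiveProb g b j := by
    nth_rewrite 2 [sensitiveProb]
    rw [← h, sensitiveProb, ← cubeMean_add, influence_eq_cubeMean]
    congr 1
    funext x
    rw [flipAt_flipAt]
    cases g x <;> cases g (flipAt j x) <;> cases b <;> simp
  rw [h2]
  ring

lemma sensitiveProb_le_valueProb (g : (Fin n → Bool) → Bool) (b : Bool) (j : Fin n) :
    sensitiveProb g b j ≤ valueProb g b := by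
  refine cubeMean_mono fun x => ?_
  split_ifs <;> simp_all

lemma sensitiveProb_update_self (g : (Fin n → Bool) → Bool) (b c : Bool) (i : Fin n) :
    sensitiveProb (fun x => g (Function.update x i c)) b i = 0 := by
  refine cubeMean_eq_of_forall_eq fun x => ?_
  simp [flipAt]

lemma sensitiveProb_eq_half_add (g : (Fin n → Bool) → Bool) (b : Bool) {i j : Fin n}
    (hij : j ≠ i) :
    sensitiveProb g b j = (sensitiveProb (fun x => g (Function.update x i false)) b j +
      sensitiveProb (fun x => g (Function.update x i true)) b j) / 2 := by
  have h : ∀ c x, Function.update (flipAt j x) i c = flipAt j (Function.update x i c) := by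
    intro c x
    simp only [flipAt, Function.update_of_ne hij]
    exact Function.update_comm hij _ _ _
  simp only [sensitiveProb, h]
  exact cubeMean_eq_half_add _ i

lemma sum_sensitiveProb_le (g : (Fin n → Bool) → Bool) (b : Bool) (i : Fin n) :
    ∑ j, sensitiveProb g b j ≤ valueProb g b +
      ((∑ j, sensitiveProb (fun x => g (Function.update x i false)) b j) +
        ∑ j, sensitiveProb (fun x => g (Function.update x i true)) b j) / 2 := by
  rw [← Finset.sum_add_distrib, Finset.sum_div, ← Finset.add_sum_erase _ _ (Finset.mem_univ i),
    ← Finset.add_sum_erase (a := i) _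
      (fun j => (sensitiveProb (fun x => g (Function.update x i false)) b j +
      sensitiveProb (fun x => g (Function.update x i true)) b j) / 2) (Finset.mem_univ i),
    Finset.sum_congr rfl fun j hj => sensitiveProb_eq_half_add g b (Finset.ne_of_mem_erase hj)]
  simp only [sensitiveProb_update_self]
  linarith [sensitiveProb_le_valueProb g b i]

lemma mul_log_sub_mul_log_le {a u : ℝ} (ha : 0 ≤ a) (hu : 0 < u) :
    a * Real.log u - a * Real.log a ≤ u - a := by
  rcases ha.eq_or_lt with rfl | ha
  · simpa using hu.le
  · have h := Real.log_le_sub_one_of_pos (div_pos hu ha)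
    rw [Real.log_div hu.ne' ha.ne'] at h
    have h' := mul_le_mul_of_nonneg_left h ha.le
    have : a * (u / a - 1) = u - a := by field_simp
    linarith

/-- The log-sum inequality for two terms. -/
lemma log_sum_inequality {a b A B : ℝ} (ha : 0 ≤ a) (hb : 0 ≤ b) (hA : 0 < A) (hB : 0 < B) :
    (a * Real.log A - a * Real.log a) + (b * Real.log B - b * Real.log b) ≤
      (a + b) * Real.log (A + B) - (a + b) * Real.log (a + b) := by
  rcases (add_nonneg ha hb).eq_or_lt with h | h
  · obtain rfl : a = 0 := by linarith
    obtain rfl : b = 0 := by linarith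
    simp
  · have hs : 0 < A + B := by positivity
    have h1 := mul_log_sub_mul_log_le ha (u := A * (a + b) / (A + B)) (by positivity)
    have h2 := mul_log_sub_mul_log_le hb (u := B * (a + b) / (A + B)) (by positivity)
    rw [Real.log_div (by positivity) hs.ne', Real.log_mul hA.ne' h.ne'] at h1
    rw [Real.log_div (by positivity) hs.ne', Real.log_mul hB.ne' h.ne'] at h2
    have h3 : A * (a + b) / (A + B) + B * (a + b) / (A + B) = a + b := by field_simp
    linarith

lemma sum_sensitiveProb_mul_log_two_le {g : (Fin n → Bool) → Bool} {s : ℕ}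
    (hg : ComputableInSize g s) (b : Bool) :
    (∑ j, sensitiveProb g b j) * Real.log 2 ≤
      valueProb g b * Real.log s - valueProb g b * Real.log (valueProb g b) := by
  refine ComputableInSize.induction (P := fun g s =>
    (∑ j, sensitiveProb g b j) * Real.log 2 ≤
      valueProb g b * Real.log s - valueProb g b * Real.log (valueProb g b)) ?_ ?_ hg
  · intro c s hs
    have h : 0 ≤ Real.log s := Real.log_nonneg (by exact_mod_cast hs)
    have hS : ∀ j, sensitiveProb (fun _ : Fin n → Bool => c) b j = 0 := by
      intro j
      simp [sensitiveProb, cubeMean_const]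
    simp only [hS, Finset.sum_const_zero, zero_mul, valueProb, cubeMean_const]
    split_ifs <;> simp [h]
  · intro g i s0 s1 s h0 h1 hs ih0 ih1
    have hp0 : (0 : ℝ) < s0 := by exact_mod_cast h0
    have hp1 : (0 : ℝ) < s1 := by exact_mod_cast h1
    have e : valueProb g b = valueProb (fun x => g (Function.update x i false)) b / 2 +
        valueProb (fun x => g (Function.update x i true)) b / 2 := by
      rw [← add_div]
      exact cubeMean_eq_half_add _ i
    have hS := sum_sensitiveProb_le g b i
    have n0 := valueProb_nonneg (fun x => g (Function.update x i false)) b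
    have n1 := valueProb_nonneg (fun x => g (Function.update x i true)) b
    set p0 := valueProb (fun x => g (Function.update x i false)) b
    set p1 := valueProb (fun x => g (Function.update x i true)) b
    have half : ∀ p : ℝ, p / 2 * Real.log (p / 2) = (p * Real.log p - p * Real.log 2) / 2 := by
      intro p
      by_cases hp : p = 0
      · simp [hp]
      · rw [Real.log_div hp (by norm_num)]
        ring
    have hls := log_sum_inequality (div_nonneg n0 zero_le_two)
      (div_nonneg n1 zero_le_two) hp0 hp1
    rw [half, half, ← e] at hls
    have hmono : Real.log (s0 + s1) ≤ Real.log s :=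
      Real.log_le_log (by positivity) (by exact_mod_cast hs)
    have hmono' := mul_le_mul_of_nonneg_left hmono (valueProb_nonneg g b)
    have hlog2 : 0 < Real.log 2 := Real.log_pos (by norm_num)
    have hS' := mul_le_mul_of_nonneg_right hS hlog2.le
    have e2 : valueProb g b * Real.log 2 = p0 / 2 * Real.log 2 + p1 / 2 * Real.log 2 := by
      rw [e]; ring
    linarith

lemma totalInfluence_mul_log_two_le {g : (Fin n → Bool) → Bool} {s : ℕ}
    (hg : ComputableInSize g s) (b : Bool) :
    totalInfluence g * Real.log 2 ≤
      2 * (valueProb g b * Real.log s - valueProb g b * Real.log (valueProb g b)) := by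
  have h : totalInfluence g = 2 * ∑ j, sensitiveProb g b j := by
    rw [totalInfluence, Finset.mul_sum]
    exact Finset.sum_congr rfl fun j _ => influence_eq_two_mul_sensitiveProb g b j
  rw [h]
  linarith [sum_sensitiveProb_mul_log_two_le hg b]

/-- The bound `Inf(g) ≤ Var(g) · log₂ (4s / Var(g))` for functions computed by decision trees
of size `s`. -/
lemma totalInfluence_mul_log_two_le_varf {g : (Fin n → Bool) → Bool} {s : ℕ} (hs : 1 ≤ s)
    (hg : ComputableInSize g s) :
    totalInfluence g * Real.log 2 ≤
      varf g * Real.log (4 * s) - varf g * Real.log (varf g) := by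
  obtain ⟨b, hb⟩ : ∃ b, valueProb g b ≤ 1 / 2 := by
    by_contra! h
    have := valueProb_add_valueProb_not g true
    linarith [h true, h (!true)]
  have h1 := totalInfluence_mul_log_two_le hg b
  have hp := valueProb_nonneg g b
  have hv := varf_eq_valueProb g b
  rw [eq_sub_iff_add_eq'.mpr (valueProb_add_valueProb_not g b)] at hv
  set p := valueProb g b
  rcases hp.eq_or_lt with hp0 | hp0
  · rw [hv]
    simpa [← hp0] using h1
  · have hs' : (1 : ℝ) ≤ s := by exact_mod_cast hs
    have hs0 : (0 : ℝ) < s := by linarith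
    have hle : 2 * p ≤ varf g := by rw [hv]; nlinarith
    have hle' : varf g ≤ 4 * p := by rw [hv]; nlinarith
    have hv0 : 0 < varf g := by linarith
    have hlog : Real.log (varf g) ≤ Real.log 4 + Real.log p := by
      rw [← Real.log_mul (by norm_num) hp0.ne']
      exact Real.log_le_log hv0 hle'
    have hnn : 0 ≤ Real.log s - Real.log p := by
      linarith [Real.log_nonneg hs', Real.log_nonpos hp (by linarith)]
    rw [Real.log_mul (by norm_num) hs0.ne']
    calc totalInfluence g * Real.log 2 ≤ 2 * p * (Real.log s - Real.log p) := by linarith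
      _ ≤ varf g * (Real.log s - Real.log p) := by gcongr
      _ ≤ varf g * (Real.log 4 + Real.log s - Real.log (varf g)) :=
        mul_le_mul_of_nonneg_left (by linarith) hv0.le
      _ = _ := by ring

lemma varf_nonneg (g : (Fin n → Bool) → Bool) : 0 ≤ varf g := by
  unfold varf
  positivity

lemma totalInfluence_mul_log_two_le_linear {g : (Fin n → Bool) → Bool} {s : ℕ} (hs : 1 ≤ s)
    (hg : ComputableInSize g s) {ε : ℝ} (hε : 0 < ε) :
    totalInfluence g * Real.log 2 ≤ varf g * (Real.log (4 * s / ε) - 1) + ε := by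
  have hs0 : (0 : ℝ) < s := by exact_mod_cast hs
  have h1 := totalInfluence_mul_log_two_le_varf hs hg
  have h2 := mul_log_sub_mul_log_le (varf_nonneg g) hε
  rw [Real.log_div (by positivity) hε.ne']
  linarith

lemma BareTree.length_leafPaths (B : BareTree n) : B.leafPaths.length = B.size := by
  induction B with
  | leaf => rfl
  | node i t0 t1 h0 h1 => simp [BareTree.leafPaths, BareTree.size, h0, h1]

lemma BareTree.one_le_size (B : BareTree n) : 1 ≤ B.size := by
  induction B with
  | leaf => exact le_rfl
  | node i t0 t1 h0 h1 => simp only [BareTree.size]; omega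

lemma BareTree.sum_half_pow_length_leafPaths (B : BareTree n) :
    (B.leafPaths.map fun π => ((1 : ℝ) / 2) ^ π.length).sum = 1 := by
  induction B with
  | leaf => simp [BareTree.leafPaths]
  | node i t0 t1 h0 h1 =>
    simp only [BareTree.leafPaths, List.map_append, List.sum_append, List.map_map,
      Function.comp_def, List.length_cons, pow_succ, List.sum_map_mul_right, h0, h1]
    norm_num

/-- The average variance of the restrictions of `f` at the leaves of a bare tree. -/
def leafVariance (f : (Fin n → Bool) → Bool) (B : BareTree n) : ℝ :=
  (B.leafPaths.map fun π => ((1 : ℝ) / 2) ^ π.length * varf (restrictList f π)).sum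

lemma costf_mul_log_two_le {f : (Fin n → Bool) → Bool} {s : ℕ} (hs : 1 ≤ s)
    (hf : ComputableInSize f s) {ε : ℝ} (hε : 0 < ε) (B : BareTree n) :
    costf f B * Real.log 2 ≤ leafVariance f B * (Real.log (4 * s / ε) - 1) + ε := by
  calc costf f B * Real.log 2
      = (B.leafPaths.map fun π => ((1 : ℝ) / 2) ^ π.length *
          totalInfluence (restrictList f π) * Real.log 2).sum := by
        rw [costf, List.sum_map_mul_right]
    _ ≤ (B.leafPaths.map fun π => ((1 : ℝ) / 2) ^ π.length * varf (restrictList f π) *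
          (Real.log (4 * s / ε) - 1) + ((1 : ℝ) / 2) ^ π.length * ε).sum := by
        refine List.sum_le_sum fun π _ => ?_
        have h := totalInfluence_mul_log_two_le_linear hs (hf.restrictList π) hε
        have h' := mul_le_mul_of_nonneg_left h (by positivity : (0 : ℝ) ≤ (1 / 2) ^ π.length)
        linarith
    _ = leafVariance f B * (Real.log (4 * s / ε) - 1) + ε := by
        rw [List.sum_map_add, List.sum_map_mul_right, List.sum_map_mul_right,
          B.sum_half_pow_length_leafPaths, one_mul, leafVariance]

lemma costf_le_leafVariance_mul_logb {f : (Fin n → Bool) → Bool} {s : ℕ} (hs : 1 ≤ s)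
    (hf : ComputableInSize f s) {ε : ℝ} (hε0 : 0 < ε) (hε1 : ε < 1) (B : BareTree n)
    (hcost : ε * Real.logb 2 (4 * s / ε) ≤ costf f B) :
    costf f B ≤ leafVariance f B * Real.logb 2 (4 * s / ε) := by
  have hs' : (1 : ℝ) ≤ s := by exact_mod_cast hs
  have hlog2 : 0 < Real.log 2 := Real.log_pos (by norm_num)
  have h := costf_mul_log_two_le hs hf hε0 B
  have hK : 1 < Real.log (4 * s / ε) := by
    rw [Real.lt_log_iff_exp_lt (by positivity), lt_div_iff₀ hε0]
    nlinarith [Real.exp_one_lt_d9, Real.exp_pos 1]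
  have hlogb : Real.logb 2 (4 * s / ε) * Real.log 2 = Real.log (4 * s / ε) :=
    div_mul_cancel₀ _ hlog2.ne'
  have hcost' := mul_le_mul_of_nonneg_right hcost hlog2.le
  rw [mul_assoc, hlogb] at hcost'
  have hV : ε ≤ leafVariance f B := by nlinarith
  refine le_of_mul_le_mul_right ?_ hlog2
  rw [mul_assoc, hlogb]
  linarith

end TopDownDT

/-- If `f` is computable by a decision tree of size `s ≥ 2`,
`ε ∈ (0,1)`, and `T°` is a bare tree with `L` leaves such that
`cost_f(T°) ≥ ε·log₂(4s/ε)`, then some leaf `ℓ` of `T°` and some variable `i` satisfy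
`2^{−|ℓ|}·Inf_i(f_ℓ) ≥ cost_f(T°)/(L·log₂(4s/ε)·log₂ s)`. -/
theorem exists_high_score_leaf_multiplicative
    {n : ℕ} (f : (Fin n → Bool) → Bool) (s : ℕ) (hs : 2 ≤ s)
    (T : DecTree n) (hT : ∀ x, T.eval x = f x) (hTs : T.size = s)
    (ε : ℝ) (hε0 : 0 < ε) (hε1 : ε < 1) (B : BareTree n)
    (hcost : ε * Real.logb 2 (4 * s / ε) ≤ costf f B) :
    ∃ π ∈ B.leafPaths, ∃ i : Fin n,
      costf f B / (B.size * Real.logb 2 (4 * s / ε) * Real.logb 2 s) ≤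
        ((1 : ℝ) / 2) ^ π.length * influence (restrictList f π) i := by
  have hs' : (2 : ℝ) ≤ s := by exact_mod_cast hs
  have hf : ComputableInSize f s := ⟨T, hT, hTs.le⟩
  have hne : Nonempty (Fin n) := by
    cases T with
    | leaf b => simp only [DecTree.size] at hTs; omega
    | node i t0 t1 => exact ⟨i⟩
  have hB : (0 : ℝ) < B.size := by exact_mod_cast B.one_le_size
  have hlogs : 0 < Real.logb 2 s := Real.logb_pos (by norm_num) (by linarith)
  have hK : 0 < Real.logb 2 (4 * s / ε) := by
    apply Real.logb_pos (by norm_num)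
    rw [lt_div_iff₀ hε0]
    linarith
  have hV := costf_le_leafVariance_mul_logb (by omega) hf hε0 hε1 B hcost
  obtain ⟨π, hπ, hle⟩ : ∃ π ∈ B.leafPaths, leafVariance f B / B.size ≤
      ((1 : ℝ) / 2) ^ π.length * varf (restrictList f π) := by
    refine List.exists_le_of_sum_le ?_ _ _ ?_
    · rw [← List.length_pos_iff, B.length_leafPaths]
      exact B.one_le_size
    · rw [List.map_const', List.sum_replicate, B.length_leafPaths, nsmul_eq_mul,
        mul_div_cancel₀ _ hB.ne', leafVariance]
  obtain ⟨i, hi⟩ := exists_varf_le_influence_mul_logb (hf.restrictList π)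
  refine ⟨π, hπ, i, ?_⟩
  rw [div_le_iff₀ hB] at hle
  rw [div_le_iff₀ (by positivity)]
  have hw : (0 : ℝ) ≤ (1 / 2) ^ π.length := by positivity
  calc costf f B ≤ leafVariance f B * Real.logb 2 (4 * s / ε) := hV
    _ ≤ (1 / 2) ^ π.length * (influence (restrictList f π) i * Real.logb 2 s) * B.size *
          Real.logb 2 (4 * s / ε) := by
        gcongr
        exact hle.trans (by gcongr)
    _ = _ := by ring
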